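/- arXiv:2101.03853 — 7 statements merged into one kernel-verified Lean document; each statement's English description precedes it below -/
import Mathlib

section
/- Let ν > -1 and 0 < α < ν + 1 with α ≠ 1, and for x ≥ 1 set s_x = (α/(ν+x)) ∏_{y=1}^{x-1} (1 - α/(ν+y)). Then s_x is asymptotically equivalent, as x → ∞, to α Γ(ν+1) x^{-(α+1)} / Γ(ν+1-α). -/
open Filter Finset

/-- Power-law asymptotics of the extended Sibuya probability mass function:
for `ν > -1`, `0 < α < ν + 1`, `α ≠ 1`,
`s_x = (α/(ν+x)) ∏_{y=1}^{x-1} (1 - α/(ν+y)) ~ α Γ(ν+1) x^{-(α+1)} / Γ(ν+1-α)`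
as `x → ∞`. -/
theorem sibuya_pmf_asymptotics (ν α : ℝ) (hν : -1 < ν) (hα : 0 < α)
    (hαν : α < ν + 1) (hα1 : α ≠ 1) :
    Tendsto (fun x : ℕ =>
        ((α / (ν + (x : ℝ))) * ∏ y ∈ Finset.Ico 1 x, (1 - α / (ν + (y : ℝ)))) /
          (α * Real.Gamma (ν + 1) * (x : ℝ) ^ (-(α + 1)) / Real.Gamma (ν + 1 - α)))
      atTop (nhds 1) := by
  have ha : 0 < ν + 1 := by linarith
  have hb : 0 < ν + 1 - α := by linarith
  have hGa := Real.Gamma_pos_of_pos ha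
  have hGb := Real.Gamma_pos_of_pos hb
  have key : ∀ n : ℕ, ∏ y ∈ Finset.Ico 1 (n + 1), (1 - α / (ν + (y : ℝ))) =
      (∏ j ∈ Finset.range n, (ν + 1 - α + (j : ℝ))) /
        ∏ j ∈ Finset.range n, (ν + 1 + (j : ℝ)) := by
    intro n
    rw [Finset.prod_Ico_eq_prod_range, ← Finset.prod_div_distrib]
    refine Finset.prod_congr (by simp) fun j _ => ?_
    have hj : (0 : ℝ) ≤ j := Nat.cast_nonneg j
    have h1 : ν + 1 + (j : ℝ) ≠ 0 := by positivity
    have h2 : ν + (1 + (j : ℝ)) ≠ 0 := by rw [← add_assoc]; exact h1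
    push_cast
    field_simp
    ring
  have l1 := tendsto_add_mul_div_add_mul_atTop_nhds (𝕜 := ℝ) 0 (ν - α) 1 (d := 1) one_ne_zero
  have l2 := tendsto_add_mul_div_add_mul_atTop_nhds (𝕜 := ℝ) (ν + 1) (ν + 1 - α) 1 (d := 1)
    one_ne_zero
  have l3 := ((Real.GammaSeq_tendsto_Gamma (ν + 1)).div
    (Real.GammaSeq_tendsto_Gamma (ν + 1 - α)) hGb.ne').mul_const
      (Real.Gamma (ν + 1 - α) / Real.Gamma (ν + 1))
  have l4 := (l1.mul l2).mul l3
  have e : (1 / 1 : ℝ) * (1 / 1) * (Real.Gamma (ν + 1) / Real.Gamma (ν + 1 - α) *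
      (Real.Gamma (ν + 1 - α) / Real.Gamma (ν + 1))) = 1 := by
    field_simp
  rw [e] at l4
  refine l4.congr' ?_
  filter_upwards [eventually_ge_atTop 1] with x hx
  obtain ⟨n, rfl⟩ : ∃ n, x = n + 1 := ⟨x - 1, by omega⟩
  rw [key]
  have hn : (0 : ℝ) ≤ n := Nat.cast_nonneg n
  have hA : 0 < ∏ j ∈ Finset.range n, (ν + 1 + (j : ℝ)) :=
    Finset.prod_pos fun j _ => by positivity
  have hB : 0 < ∏ j ∈ Finset.range n, (ν + 1 - α + (j : ℝ)) :=
    Finset.prod_pos fun j _ => by positivity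
  have hx0 : (0 : ℝ) < ((n + 1 : ℕ) : ℝ) := by positivity
  have hf : (0 : ℝ) < ((n + 1).factorial : ℝ) := by positivity
  simp only [Pi.div_apply, Real.GammaSeq]
  rw [Finset.prod_range_succ, Finset.prod_range_succ, Finset.prod_range_succ,
    Finset.prod_range_succ]
  have r1 : ((n + 1 : ℕ) : ℝ) ^ (ν + 1) =
      ((n + 1 : ℕ) : ℝ) ^ (ν + 1 - α) * ((n + 1 : ℕ) : ℝ) ^ α := by
    rw [← Real.rpow_add hx0]; congr 1; ring
  have r2 : ((n + 1 : ℕ) : ℝ) ^ (-(α + 1)) =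
      (((n + 1 : ℕ) : ℝ) ^ α * ((n + 1 : ℕ) : ℝ))⁻¹ := by
    rw [Real.rpow_neg hx0.le, Real.rpow_add_one hx0.ne']
  rw [r1, r2]
  have p1 := Real.rpow_pos_of_pos hx0 α
  have p2 := Real.rpow_pos_of_pos hx0 (ν + 1 - α)
  generalize ((n + 1 : ℕ) : ℝ) ^ α = u at *
  generalize ((n + 1 : ℕ) : ℝ) ^ (ν + 1 - α) = v at *
  generalize ((n + 1).factorial : ℝ) = f at *
  generalize ∏ j ∈ Finset.range n, (ν + 1 + (j : ℝ)) = A at *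
  generalize ∏ j ∈ Finset.range n, (ν + 1 - α + (j : ℝ)) = B at *
  generalize Real.Gamma (ν + 1) = G at *
  generalize Real.Gamma (ν + 1 - α) = H at *
  push_cast
  have q1 : ν - α + 1 * ((n : ℝ) + 1) = ν + 1 - α + n := by ring
  have q2 : ν + 1 - α + 1 * ((n : ℝ) + 1) = ν + 1 - α + n + 1 := by ring
  have q3 : ν + 1 - α + ((n : ℝ) + 1) = ν + 1 - α + n + 1 := by ring
  have q4 : ν + 1 + ((n : ℝ) + 1) = ν + 1 + n + 1 := by ring
  have q5 : ν + ((n : ℝ) + 1) = ν + 1 + n := by ring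
  have q6 : ν + 1 + 1 * ((n : ℝ) + 1) = ν + 1 + n + 1 := by ring
  rw [q1, q2, q3, q4, q5, q6]
  have w1 : 0 < ν + 1 - α + (n : ℝ) := by positivity
  have w2 : 0 < ν + 1 + (n : ℝ) := by positivity
  generalize ν + 1 - α + (n : ℝ) = b at *
  generalize ν + 1 + (n : ℝ) = a at *
  field_simp
  try ring
end

section
/- Let ν > 0 and 1 < α < ν + 1. Then ∑_{x=1}^{∞} ∏_{y=1}^{x-1} (1 - α/(ν+y)) = ν/(α - 1). Consequently, for the critical catastrophe chain with q_x = α/(ν+x) (x ≥ 1) and reflection probability p_0 at the origin, the mean return time to the origin equals E(τ_{0,0}) = 1 + p_0 ν/(α-1), and the mean length of a true excursion equals μ⁺ = 1 + ν/(α-1). -/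
open Finset

/-- The survival sum, by telescoping `(ν + n) P n - (ν + n + 1) P (n + 1) = (α - 1) P n`. -/
theorem hasSum_survival (ν α : ℝ) (hν : 0 < ν) (hα : 1 < α) (hαν : α < ν + 1) :
    HasSum (fun n : ℕ => ∏ y ∈ Finset.Icc 1 n, (1 - α / (ν + (y : ℝ)))) (ν / (α - 1)) := by
  set P : ℕ → ℝ := fun n => ∏ y ∈ Finset.Icc 1 n, (1 - α / (ν + (y : ℝ))) with hP
  have hpos : ∀ n, 0 < P n := by
    intro n
    refine Finset.prod_pos fun y hy => ?_
    have h1 : (1 : ℝ) ≤ y := by exact_mod_cast (Finset.mem_Icc.mp hy).1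
    rw [sub_pos, div_lt_one (by linarith)]
    linarith
  have hsucc : ∀ n, P (n + 1) = P n * (1 - α / (ν + ((n : ℝ) + 1))) := by
    intro n
    simp only [hP]
    rw [Finset.prod_Icc_succ_top (by omega)]
    push_cast
    rfl
  have hstep : ∀ n : ℕ, (ν + (n : ℝ)) * P n - (ν + ((n : ℝ) + 1)) * P (n + 1) =
      (α - 1) * P n := by
    intro n
    have h : ν + ((n : ℝ) + 1) ≠ 0 := by positivity
    rw [hsucc]
    field_simp
    ring
  have hsum : ∀ n : ℕ, (α - 1) * ∑ i ∈ Finset.range n, P i = ν - (ν + (n : ℝ)) * P n := by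
    intro n
    induction n with
    | zero => simp [hP]
    | succ k ih =>
      rw [Finset.sum_range_succ, mul_add, ih, ← hstep k]
      push_cast
      ring
  have ha : 0 < α - 1 := by linarith
  have hsm : Summable P := by
    refine summable_of_sum_range_le (c := ν / (α - 1)) (fun n => (hpos n).le) fun n => ?_
    rw [le_div_iff₀ ha, mul_comm, hsum]
    have : 0 < (ν + (n : ℝ)) * P n := mul_pos (by positivity) (hpos n)
    linarith
  have hlim := hsm.hasSum.tendsto_sum_nat
  set S := ∑' n, P n with hS
  have hb : Filter.Tendsto (fun n : ℕ => (ν + (n : ℝ)) * P n) Filter.atTop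
      (nhds (ν - (α - 1) * S)) := by
    have := (hlim.const_mul (α - 1)).const_sub ν
    refine this.congr fun n => ?_
    rw [hsum]
    ring
  have hle : ∀ n : ℕ, ν - (α - 1) * S ≤ (ν + (n : ℝ)) * P n := by
    intro n
    have h1 := hsm.sum_le_tsum (Finset.range n) (fun i _ => (hpos i).le)
    have h2 := mul_le_mul_of_nonneg_left h1 ha.le
    rw [hsum] at h2
    linarith
  have hL0 : 0 ≤ ν - (α - 1) * S :=
    ge_of_tendsto' hb fun n => mul_nonneg (by positivity) (hpos n).le
  have hL : ν - (α - 1) * S = 0 := by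
    by_contra hne
    have hLpos : 0 < ν - (α - 1) * S := lt_of_le_of_ne hL0 (Ne.symm hne)
    obtain ⟨N, hN⟩ := exists_nat_ge ν
    have hs : Summable fun n : ℕ => (ν - (α - 1) * S) * (1 / ((n + N : ℕ) : ℝ)) := by
      refine Summable.of_nonneg_of_le (fun n => by positivity) (fun n => ?_) hsm
      have hc : (0 : ℝ) < ((n + N : ℕ) : ℝ) := by
        push_cast
        have : (0 : ℝ) ≤ n := by positivity
        linarith
      rw [mul_one_div, div_le_iff₀ hc]
      refine (hle n).trans ?_
      rw [mul_comm]
      refine mul_le_mul_of_nonneg_left ?_ (hpos n).le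
      push_cast
      linarith
    rw [summable_mul_left_iff hne] at hs
    exact Real.not_summable_one_div_natCast
      ((summable_nat_add_iff (f := fun n : ℕ => 1 / (n : ℝ)) N).mp hs)
  have : S = ν / (α - 1) := by
    rw [eq_div_iff ha.ne']
    linarith
  rw [← this]
  exact hsm.hasSum

/-- Mean return time to the origin of the critical catastrophe chain: for
`ν > 0` and `1 < α < ν + 1`,
`∑_{x≥1} ∏_{y=1}^{x-1} (1 - α/(ν+y)) = ν/(α-1)`; hence the mean return time
to the origin is `E(τ₀₀) = 1 + p₀ ν/(α-1)` and the mean true excursion length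
is `μ⁺ = 1 + ν/(α-1)`. -/
theorem critical_mean_return_time (ν α p₀ : ℝ) (hν : 0 < ν) (hα : 1 < α)
    (hαν : α < ν + 1) (hp₀ : 0 < p₀) (hp₀' : p₀ ≤ 1) :
    (∑' n : ℕ, ∏ y ∈ Finset.Icc 1 n, (1 - α / (ν + (y : ℝ)))) = ν / (α - 1) ∧
    (1 + ∑' n : ℕ, p₀ * ∏ y ∈ Finset.Icc 1 n, (1 - α / (ν + (y : ℝ)))) =
      1 + p₀ * (ν / (α - 1)) ∧
    (1 + ∑' n : ℕ, ∏ y ∈ Finset.Icc 1 n, (1 - α / (ν + (y : ℝ)))) =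
      1 + ν / (α - 1) := by
  have h := hasSum_survival ν α hν hα hαν
  refine ⟨h.tsum_eq, ?_, ?_⟩
  · rw [(h.mul_left p₀).tsum_eq]
  · rw [h.tsum_eq]
end

section
/- Let ν > 0 and let z be a real number with |z| < 1. Then ∑_{x≥1} z^x (1/(ν+x)) ∏_{y=1}^{x-1} (1 - 1/(ν+y)) = z - ν (1-z) L_ν(z), where L_ν(z) = ∑_{n≥1} z^n/(ν+n). -/
open Finset

/-- The pgf of the extended Sibuya distribution with `α = 1`: for `ν > 0` and
`|z| < 1`, `∑_{x≥1} z^x (1/(ν+x)) ∏_{y=1}^{x-1} (1 - 1/(ν+y)) = z - ν(1-z) L_ν(z)`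
where `L_ν(z) = ∑_{n≥1} z^n/(ν+n)`. -/
theorem sibuya_pgf_alpha_one (ν z : ℝ) (hν : 0 < ν) (hz : |z| < 1) :
    (∑' x : ℕ, z ^ (x + 1) * (1 / (ν + ((x : ℝ) + 1))) *
        ∏ y ∈ Finset.Icc 1 x, (1 - 1 / (ν + (y : ℝ)))) =
      z - ν * (1 - z) * ∑' n : ℕ, z ^ (n + 1) / (ν + ((n : ℝ) + 1)) := by
  have hprod : ∀ x : ℕ, ∏ y ∈ Finset.Icc 1 x, (1 - 1 / (ν + (y : ℝ))) = ν / (ν + (x : ℝ)) := by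
    intro x
    induction x with
    | zero => simp [hν.ne']
    | succ k ih =>
      rw [Finset.prod_Icc_succ_top (by omega), ih]
      have h1 : ν + (k : ℝ) ≠ 0 := by positivity
      have h2 : ν + ((k : ℝ) + 1) ≠ 0 := by positivity
      push_cast
      field_simp
      ring
  have hg : Summable (fun n : ℕ => z ^ n / (ν + (n : ℝ))) := by
    have hs : Summable (fun n : ℕ => |z| ^ n / ν) :=
      (summable_geometric_of_lt_one (abs_nonneg z) hz).div_const ν
    refine Summable.of_norm_bounded hs (fun n => ?_)
    have h1 : 0 < ν + (n : ℝ) := by positivity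
    rw [Real.norm_eq_abs, abs_div, abs_pow, abs_of_pos h1]
    gcongr
    have : (0 : ℝ) ≤ n := by positivity
    linarith
  have hg1 : Summable (fun n : ℕ => z ^ (n + 1) / (ν + ((n : ℝ) + 1))) := by
    have := (summable_nat_add_iff 1).2 hg
    simpa using this
  have h0 := hg.tsum_eq_zero_add
  push_cast at h0
  have hterm : ∀ x : ℕ, z ^ (x + 1) * (1 / (ν + ((x : ℝ) + 1))) *
        ∏ y ∈ Finset.Icc 1 x, (1 - 1 / (ν + (y : ℝ))) =
      ν * z * (z ^ x / (ν + (x : ℝ))) - ν * (z ^ (x + 1) / (ν + ((x : ℝ) + 1))) := by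
    intro x
    rw [hprod]
    have h1 : ν + (x : ℝ) ≠ 0 := by positivity
    have h2 : ν + ((x : ℝ) + 1) ≠ 0 := by positivity
    field_simp
    ring
  rw [tsum_congr hterm, (hg.mul_left _).tsum_sub (hg1.mul_left _), tsum_mul_left,
    tsum_mul_left, h0]
  simp only [pow_zero, add_zero]
  field_simp
  ring
end

section
/- Let ν > -1 and 0 < α < 1 with α < ν + 1, and define ψ₀(z) = ∑_{x≥1} z^x (α/(ν+x)) ∏_{y=1}^{x-1} (1 - α/(ν+y)) for real z ∈ [0,1). Then (1 - ψ₀(z)) / (1-z)^α converges to Γ(ν+1) Γ(1-α) / Γ(ν+1-α) as z → 1⁻. -/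
open Filter Finset

/-- survival products -/
noncomputable def sibP (ν α : ℝ) (n : ℕ) : ℝ := ∏ y ∈ Finset.Icc 1 n, (1 - α / (ν + (y : ℝ)))

lemma sibP_zero (ν α : ℝ) : sibP ν α 0 = 1 := by simp [sibP]

lemma sibP_succ (ν α : ℝ) (n : ℕ) :
    sibP ν α (n + 1) = sibP ν α n * (1 - α / (ν + ((n : ℝ) + 1))) := by
  unfold sibP
  rw [Finset.prod_Icc_succ_top (by omega)]
  push_cast
  rfl

lemma sibP_mem (ν α : ℝ) (hν : -1 < ν) (hα0 : 0 < α) (hαν : α < ν + 1) (n : ℕ) :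
    0 < sibP ν α n ∧ sibP ν α n ≤ 1 := by
  induction n with
  | zero => simp [sibP_zero]
  | succ n ih =>
    rw [sibP_succ]
    have hn : (0 : ℝ) ≤ n := n.cast_nonneg
    have hd : 0 < ν + ((n : ℝ) + 1) := by linarith
    have h1 : α / (ν + ((n : ℝ) + 1)) < 1 := by
      rw [div_lt_one hd]; linarith
    have h2 : 0 < α / (ν + ((n : ℝ) + 1)) := by positivity
    constructor
    · exact mul_pos ih.1 (by linarith)
    · nlinarith [ih.1, ih.2]

lemma sibP_summable (ν α : ℝ) (hν : -1 < ν) (hα0 : 0 < α) (hαν : α < ν + 1)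
    {z : ℝ} (h0 : 0 ≤ z) (h1 : z < 1) : Summable fun n => sibP ν α n * z ^ n := by
  refine Summable.of_nonneg_of_le (fun n => ?_) (fun n => ?_) (summable_geometric_of_lt_one h0 h1)
  · exact mul_nonneg (sibP_mem ν α hν hα0 hαν n).1.le (pow_nonneg h0 n)
  · exact mul_le_of_le_one_left (pow_nonneg h0 n) (sibP_mem ν α hν hα0 hαν n).2

lemma sib_key (ν α : ℝ) (hν : -1 < ν) (hα0 : 0 < α) (hαν : α < ν + 1)
    {z : ℝ} (h0 : 0 ≤ z) (h1 : z < 1) :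
    1 - ∑' x : ℕ, z ^ (x + 1) * (α / (ν + ((x : ℝ) + 1))) *
            ∏ y ∈ Finset.Icc 1 x, (1 - α / (ν + (y : ℝ)))
      = (1 - z) * ∑' n, sibP ν α n * z ^ n := by
  have hs := sibP_summable ν α hν hα0 hαν h0 h1
  have e : ∀ x : ℕ, z ^ (x + 1) * (α / (ν + ((x : ℝ) + 1))) *
            ∏ y ∈ Finset.Icc 1 x, (1 - α / (ν + (y : ℝ)))
      = z * (sibP ν α x * z ^ x) - sibP ν α (x + 1) * z ^ (x + 1) := by
    intro x
    rw [sibP_succ]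
    unfold sibP
    ring
  have hs' : Summable fun n => sibP ν α (n + 1) * z ^ (n + 1) :=
    (summable_nat_add_iff (f := fun n => sibP ν α n * z ^ n) 1).2 hs
  rw [tsum_congr e, (hs.mul_left z).tsum_sub hs', tsum_mul_left]
  have := hs.tsum_eq_zero_add
  rw [sibP_zero] at this
  rw [this]
  ring

lemma sibP_zero_eq (α : ℝ) (n : ℕ) :
    sibP 0 α n = Ring.choose ((1 - α) + n - 1) n := by
  rw [← Ring.multichoose_eq]
  have h := Ring.factorial_nsmul_multichoose_eq_ascPochhammer (1 - α) n
  rw [Polynomial.ascPochhammer_smeval_eq_eval, nsmul_eq_mul] at h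
  have hf : ((n.factorial : ℕ) : ℝ) ≠ 0 := by exact_mod_cast n.factorial_ne_zero
  apply mul_left_cancel₀ hf
  rw [h]
  clear h hf
  induction n with
  | zero => simp [sibP_zero]
  | succ n ih =>
    rw [ascPochhammer_succ_eval, ← ih, sibP_succ, Nat.factorial_succ]
    have : (n : ℝ) + 1 ≠ 0 := by positivity
    push_cast
    rw [zero_add]
    field_simp
    ring

lemma sibQ_sum (α : ℝ) {z : ℝ} (h0 : 0 ≤ z) (h1 : z < 1) :
    HasSum (fun n => sibP 0 α n * z ^ n) (1 / (1 - z) ^ (1 - α)) := by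
  have h := (Real.one_div_one_sub_rpow_hasFPowerSeriesOnBall_zero (1 - α)).hasSum (y := z) (by
    simp [abs_of_nonneg h0, h1, enorm_eq_nnnorm]
    exact_mod_cast (by simpa [abs_of_nonneg h0] using h1 : ‖z‖ < 1))
  simpa [sibP_zero_eq, FormalMultilinearSeries.ofScalars_apply_eq, mul_comm] using h

lemma sibP_gammaSeq (ν α : ℝ) (hν : -1 < ν) (hαν : α < ν + 1) {n : ℕ} (hn : n ≠ 0) :
    sibP ν α (n + 1) =
      Real.GammaSeq (ν + 1) n / Real.GammaSeq (ν + 1 - α) n * (n : ℝ) ^ (-α) := by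
  have hn' : (0 : ℝ) < n := by positivity
  have hp : ∀ s : ℝ, 0 < s → 0 < ∏ j ∈ Finset.range (n + 1), (s + j) :=
    fun s hs => Finset.prod_pos fun j _ => by positivity
  have e : sibP ν α (n + 1) = (∏ j ∈ Finset.range (n + 1), (ν + 1 - α + j)) /
      ∏ j ∈ Finset.range (n + 1), (ν + 1 + j) := by
    rw [← Finset.prod_div_distrib]
    clear hn hn' hp
    induction n + 1 with
    | zero => simp [sibP_zero]
    | succ m ih =>
      rw [sibP_succ, ih, Finset.prod_range_succ]
      congr 1
      have : ν + ((m : ℝ) + 1) ≠ 0 := by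
        have : (0 : ℝ) ≤ m := m.cast_nonneg
        linarith
      have : ν + 1 + (m : ℝ) ≠ 0 := by
        have : (0 : ℝ) ≤ m := m.cast_nonneg
        linarith
      field_simp
      ring
  rw [e]
  unfold Real.GammaSeq
  have h1 := (hp (ν + 1) (by linarith)).ne'
  have h2 := (hp (ν + 1 - α) (by linarith)).ne'
  have h3 : (n : ℝ) ^ (ν + 1 - α) = (n : ℝ) ^ (ν + 1) * (n : ℝ) ^ (-α) := by
    rw [← Real.rpow_add hn']; rfl
  have h4 : ((n.factorial : ℕ) : ℝ) ≠ 0 := by exact_mod_cast n.factorial_ne_zero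
  have h5 : (n : ℝ) ^ (ν + 1) ≠ 0 := (Real.rpow_pos_of_pos hn' _).ne'
  have h6 : (n : ℝ) ^ (-α) ≠ 0 := (Real.rpow_pos_of_pos hn' _).ne'
  rw [h3]
  generalize (n : ℝ) ^ (ν + 1) = A at *
  generalize (n : ℝ) ^ (-α) = B at *
  field_simp

lemma sib_ratio (ν α : ℝ) (hν : -1 < ν) (hα0 : 0 < α) (hα1 : α < 1) (hαν : α < ν + 1) :
    Tendsto (fun n => sibP ν α n / sibP 0 α n) atTop
      (nhds (Real.Gamma (ν + 1) * Real.Gamma (1 - α) / Real.Gamma (ν + 1 - α))) := by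
  rw [← tendsto_add_atTop_iff_nat 1]
  have hG : ∀ s : ℝ, 0 < s → Real.Gamma s ≠ 0 := fun s hs => (Real.Gamma_pos_of_pos hs).ne'
  have t : Tendsto (fun n => (Real.GammaSeq (ν + 1) n / Real.GammaSeq (ν + 1 - α) n) /
      (Real.GammaSeq (0 + 1) n / Real.GammaSeq (0 + 1 - α) n)) atTop
      (nhds ((Real.Gamma (ν + 1) / Real.Gamma (ν + 1 - α)) /
        (Real.Gamma (0 + 1) / Real.Gamma (0 + 1 - α)))) := by
    refine Tendsto.div ?_ ?_ ?_
    · exact (Real.GammaSeq_tendsto_Gamma _).div (Real.GammaSeq_tendsto_Gamma _)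
        (hG _ (by linarith))
    · exact (Real.GammaSeq_tendsto_Gamma _).div (Real.GammaSeq_tendsto_Gamma _)
        (hG _ (by linarith))
    · exact div_ne_zero (hG _ (by linarith)) (hG _ (by linarith))
  have e : (Real.Gamma (ν + 1) / Real.Gamma (ν + 1 - α)) /
        (Real.Gamma (0 + 1) / Real.Gamma (0 + 1 - α)) =
      Real.Gamma (ν + 1) * Real.Gamma (1 - α) / Real.Gamma (ν + 1 - α) := by
    rw [zero_add, Real.Gamma_one]
    have := hG (ν + 1 - α) (by linarith)
    have := hG (1 - α) (by linarith)
    field_simp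
  rw [e] at t
  refine t.congr' ?_
  filter_upwards [eventually_ne_atTop 0] with n hn
  rw [sibP_gammaSeq ν α hν hαν hn, sibP_gammaSeq 0 α (by norm_num) (by linarith) hn,
    mul_div_mul_right]
  exact (Real.rpow_pos_of_pos (by positivity) _).ne'

/-- Abelian comparison. -/
lemma sib_abel (p q : ℕ → ℝ) (b L : ℝ) (hb : 0 < b) (hq : ∀ n, 0 < q n)
    (hp : ∀ z : ℝ, 0 ≤ z → z < 1 → Summable fun n => p n * z ^ n)
    (hQ : ∀ z : ℝ, 0 ≤ z → z < 1 → HasSum (fun n => q n * z ^ n) (1 / (1 - z) ^ b))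
    (hr : Tendsto (fun n => p n / q n) atTop (nhds L)) :
    Tendsto (fun z : ℝ => (1 - z) ^ b * ∑' n, p n * z ^ n)
      (nhdsWithin 1 (Set.Ico (0 : ℝ) 1)) (nhds L) := by
  rw [Metric.tendsto_nhds]
  intro ε hε
  obtain ⟨N, hN⟩ := (Metric.tendsto_atTop.1 hr) (ε / 2) (by positivity)
  set K : ℝ := ∑ n ∈ Finset.range N, |p n - L * q n| with hK
  have ht : Tendsto (fun z : ℝ => (1 - z) ^ b * K) (nhdsWithin 1 (Set.Ico (0 : ℝ) 1))
      (nhds 0) := by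
    have : ContinuousAt (fun z : ℝ => (1 - z) ^ b * K) 1 := by
      refine ContinuousAt.mul ?_ continuousAt_const
      exact ContinuousAt.rpow_const (by fun_prop) (Or.inr hb.le)
    have h := this.tendsto
    simp only [sub_self, Real.zero_rpow hb.ne', zero_mul] at h
    exact h.mono_left nhdsWithin_le_nhds
  filter_upwards [ht.eventually (gt_mem_nhds (half_pos hε)), self_mem_nhdsWithin] with z hz hmem
  obtain ⟨h0, h1⟩ := hmem
  have hw : 0 < (1 - z) ^ b := Real.rpow_pos_of_pos (by linarith) b
  have hQz := hQ z h0 h1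
  have hd : Summable fun n => (p n - L * q n) * z ^ n := by
    have := (hp z h0 h1).sub (hQz.summable.mul_left L)
    refine this.congr fun n => ?_
    ring
  have hdsum : ∑' n, (p n - L * q n) * z ^ n = ∑' n, p n * z ^ n - L * (1 / (1 - z) ^ b) := by
    rw [← hQz.tsum_eq, ← tsum_mul_left, ← (hp z h0 h1).tsum_sub (hQz.summable.mul_left L)]
    refine tsum_congr fun n => ?_
    ring
  have hbound : |∑' n, (p n - L * q n) * z ^ n| ≤ K + ε / 2 * (1 / (1 - z) ^ b) := by
    have hf : HasSum (fun n => (if n ∈ Finset.range N then |p n - L * q n| else 0)) K := by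
      rw [hK, ← Finset.sum_congr rfl (fun n hn => if_pos hn)]
      exact hasSum_sum_of_ne_finset_zero (fun n hn => if_neg hn)
    have hS := hf.add (hQz.mul_left (ε / 2))
    rw [← Real.norm_eq_abs]
    refine tsum_of_norm_bounded hS fun n => ?_
    have hzn : 0 ≤ z ^ n := pow_nonneg h0 n
    have hzn1 : z ^ n ≤ 1 := pow_le_one₀ h0 h1.le
    rw [Real.norm_eq_abs, abs_mul, abs_of_nonneg hzn]
    have hqz : 0 ≤ ε / 2 * (q n * z ^ n) := by have := hq n; positivity
    split_ifs with hn
    · have := mul_le_of_le_one_right (abs_nonneg (p n - L * q n)) hzn1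
      linarith
    · rw [Finset.mem_range, not_lt] at hn
      have h := hN n hn
      rw [Real.dist_eq] at h
      have e : p n - L * q n = (p n / q n - L) * q n := by
        have := (hq n).ne'
        field_simp
      rw [e, abs_mul, abs_of_pos (hq n), zero_add, mul_assoc]
      exact mul_le_mul_of_nonneg_right h.le (mul_nonneg (hq n).le hzn)
  rw [Real.dist_eq]
  have e : (1 - z) ^ b * ∑' n, p n * z ^ n - L =
      (1 - z) ^ b * ∑' n, (p n - L * q n) * z ^ n := by
    rw [hdsum]
    field_simp
  rw [e, abs_mul, abs_of_pos hw]
  calc (1 - z) ^ b * |∑' n, (p n - L * q n) * z ^ n|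
      ≤ (1 - z) ^ b * (K + ε / 2 * (1 / (1 - z) ^ b)) := mul_le_mul_of_nonneg_left hbound hw.le
    _ = (1 - z) ^ b * K + ε / 2 := by field_simp
    _ < ε := by linarith

/-- Singular behaviour of the extended Sibuya pgf at `z = 1` when `0 < α < 1`:
`(1 - ψ₀(z))/(1-z)^α → Γ(ν+1) Γ(1-α) / Γ(ν+1-α)` as `z → 1⁻` in `[0,1)`. -/
theorem sibuya_pgf_singularity (ν α : ℝ) (hν : -1 < ν) (hα0 : 0 < α)
    (hα1 : α < 1) (hαν : α < ν + 1) :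
    Tendsto (fun z : ℝ =>
        (1 - ∑' x : ℕ, z ^ (x + 1) * (α / (ν + ((x : ℝ) + 1))) *
            ∏ y ∈ Finset.Icc 1 x, (1 - α / (ν + (y : ℝ)))) / (1 - z) ^ α)
      (nhdsWithin 1 (Set.Ico (0 : ℝ) 1))
      (nhds (Real.Gamma (ν + 1) * Real.Gamma (1 - α) / Real.Gamma (ν + 1 - α))) := by
  have h := sib_abel (sibP ν α) (sibP 0 α) (1 - α) _ (by linarith)
    (fun n => (sibP_mem 0 α (by norm_num) hα0 (by linarith) n).1)
    (fun z h0 h1 => sibP_summable ν α hν hα0 hαν h0 h1)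
    (fun z h0 h1 => sibQ_sum α h0 h1)
    (sib_ratio ν α hν hα0 hα1 hαν)
  refine h.congr' ?_
  filter_upwards [self_mem_nhdsWithin] with z hz
  rw [sib_key ν α hν hα0 hαν hz.1 hz.2, Real.rpow_sub (by linarith [hz.2]), Real.rpow_one]
  ring
end

section
/- Let ν > -1, 0 < β < 1 and 0 < α < ν + 1. Then -log ∏_{y=1}^{x} (1 - α/(ν + y^β)) is asymptotically equivalent, as x → ∞, to (α/(1-β)) x^{1-β}; in particular, the invariant measure π_x ∝ ∏_{y=0}^{x-1}(1 - α/(ν+y^β)) of the catastrophe chain has stretched exponential decay. -/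
open Filter Finset

lemma aux_slope {f : ℝ → ℝ} {d a : ℝ} (h : HasDerivAt f d a) {u : ℕ → ℝ}
    (hu : Tendsto u atTop (nhds 0)) (hu0 : ∀ n, 0 < u n) :
    Tendsto (fun n => (u n)⁻¹ * (f (a + u n) - f a)) atTop (nhds d) := by
  have h1 := hasDerivAt_iff_tendsto_slope_zero.1 h
  have h2 : Tendsto u atTop (nhdsWithin 0 {0}ᶜ) := by
    refine tendsto_nhdsWithin_iff.2 ⟨hu, Eventually.of_forall fun n => ?_⟩
    simpa using (hu0 n).ne'
  simpa [Function.comp_def] using h1.comp h2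

/-- Stretched exponential decay of the invariant measure when `0 < β < 1`:
`-log ∏_{y=1}^{x} (1 - α/(ν + y^β)) ~ (α/(1-β)) x^{1-β}` as `x → ∞`. -/
theorem stretched_exponential_decay (ν α β : ℝ) (hν : -1 < ν) (hβ0 : 0 < β)
    (hβ1 : β < 1) (hα : 0 < α) (hαν : α < ν + 1) :
    Tendsto (fun x : ℕ =>
        (-Real.log (∏ y ∈ Finset.Icc 1 x, (1 - α / (ν + (y : ℝ) ^ β)))) /
          ((α / (1 - β)) * (x : ℝ) ^ (1 - β)))
      atTop (nhds 1) := by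
  have hb : 0 < 1 - β := by linarith
  have hc : 0 < α / (1 - β) := div_pos hα hb
  have hm0 : ∀ n : ℕ, (0 : ℝ) < (n : ℝ) + 1 := fun n => by positivity
  have hpow : ∀ n : ℕ, 1 ≤ ((n : ℝ) + 1) ^ β := fun n =>
    Real.one_le_rpow (by linarith [n.cast_nonneg (α := ℝ)]) hβ0.le
  have hcast : Tendsto (fun n : ℕ => (n : ℝ) + 1) atTop atTop :=
    tendsto_atTop_add_const_right _ _ tendsto_natCast_atTop_atTop
  have hpowt : Tendsto (fun n : ℕ => ((n : ℝ) + 1) ^ β) atTop atTop :=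
    (tendsto_rpow_atTop hβ0).comp hcast
  set t : ℕ → ℝ := fun n => α / (ν + ((n : ℝ) + 1) ^ β) with ht
  have htpos : ∀ n, 0 < t n := fun n => div_pos hα (by linarith [hpow n])
  have htlt : ∀ n, t n < 1 := fun n => by
    have : 0 < ν + ((n : ℝ) + 1) ^ β := by linarith [hpow n]
    rw [ht]; simp only
    rw [div_lt_one this]; linarith [hpow n]
  have htt : Tendsto t atTop (nhds 0) :=
    Tendsto.div_atTop tendsto_const_nhds (tendsto_atTop_add_const_left _ _ hpowt)
  set a : ℕ → ℝ := fun n => -Real.log (1 - t n) with ha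
  set g : ℕ → ℝ := fun n => (((n + 1 : ℕ) : ℝ)) ^ (1 - β) - (n : ℝ) ^ (1 - β) with hg
  have hgpos : ∀ n, 0 < g n := fun n =>
    sub_pos.2 (Real.rpow_lt_rpow n.cast_nonneg (by push_cast; linarith) hb)
  have hsumg : ∀ x, ∑ n ∈ range x, g n = (x : ℝ) ^ (1 - β) := fun x => by
    rw [hg, Finset.sum_range_sub (fun n : ℕ => (n : ℝ) ^ (1 - β))]
    simp [Real.zero_rpow hb.ne']
  have hsuma : ∀ x : ℕ, -Real.log (∏ y ∈ Finset.Icc 1 x, (1 - α / (ν + (y : ℝ) ^ β)))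
      = ∑ n ∈ range x, a n := fun x => by
    have hp : ∏ y ∈ Finset.Icc 1 x, (1 - α / (ν + (y : ℝ) ^ β)) = ∏ n ∈ range x, (1 - t n) := by
      induction x with
      | zero => simp
      | succ k ih =>
        rw [Finset.prod_Icc_succ_top (by omega), ih, Finset.prod_range_succ]
        simp [ht]
    rw [hp, Real.log_prod (fun n _ => by linarith [htlt n]), ha, Finset.sum_neg_distrib]
  -- asymptotics of a
  have h1 : Tendsto (fun n => (t n)⁻¹ * a n) atTop (nhds 1) := by
    have hd : HasDerivAt (fun u : ℝ => -Real.log (1 - u)) 1 0 := by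
      have := (((hasDerivAt_id (0 : ℝ)).const_sub 1).log (by simp)).fun_neg
      simpa using this
    simpa [ha] using aux_slope hd htt htpos
  have h2 : Tendsto (fun n : ℕ => t n * ((n : ℝ) + 1) ^ β) atTop (nhds α) := by
    have h3 : Tendsto (fun n : ℕ => α - ν * t n) atTop (nhds (α - ν * 0)) :=
      tendsto_const_nhds.sub (htt.const_mul ν)
    simp only [mul_zero, sub_zero] at h3
    refine h3.congr fun n => ?_
    have : ν + ((n : ℝ) + 1) ^ β ≠ 0 := by linarith [hpow n]
    simp only [ht]
    field_simp
    ring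
  have h3 : Tendsto (fun n : ℕ => a n * ((n : ℝ) + 1) ^ β) atTop (nhds α) := by
    have := h1.mul h2
    rw [one_mul] at this
    refine this.congr fun n => ?_
    have := (htpos n).ne'
    field_simp
  have h4 : Tendsto (fun n : ℕ => g n * ((n : ℝ) + 1) ^ β) atTop (nhds (1 - β)) := by
    have hd : HasDerivAt (fun u : ℝ => -(1 - u) ^ (1 - β)) (1 - β) 0 := by
      have := (((hasDerivAt_id (0 : ℝ)).const_sub 1).rpow_const (p := 1 - β) (by simp)).fun_neg
      simpa using this
    have := aux_slope hd (tendsto_inv_atTop_zero.comp hcast) (fun n => inv_pos.2 (hm0 n))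
    refine this.congr fun n => ?_
    have hm := hm0 n
    have e1 : (1 : ℝ) - ((n : ℝ) + 1)⁻¹ = n / ((n : ℝ) + 1) := by field_simp; ring
    have e2 : ((n : ℝ) + 1) ^ (1 - β) * ((n : ℝ) + 1) ^ β = (n : ℝ) + 1 := by
      rw [← Real.rpow_add hm]; simp
    have e3 : ((n : ℝ) + 1) ^ (1 - β) ≠ 0 := (Real.rpow_pos_of_pos hm _).ne'
    simp only [Function.comp, zero_add, sub_zero, Real.one_rpow, inv_inv, e1, hg]
    rw [Real.div_rpow n.cast_nonneg hm.le]
    push_cast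
    nth_rewrite 1 [← e2]
    field_simp
    ring
  have h5 : Tendsto (fun n => a n / g n) atTop (nhds (α / (1 - β))) := by
    refine (h3.div h4 hb.ne').congr fun n => ?_
    exact mul_div_mul_right _ _ (by linarith [hpow n])
  have h6 : (fun n => a n - α / (1 - β) * g n) =o[atTop] g := by
    rw [Asymptotics.isLittleO_iff_tendsto' (Eventually.of_forall fun n h => absurd h (hgpos n).ne')]
    have := h5.sub_const (α / (1 - β))
    rw [sub_self] at this
    refine this.congr fun n => ?_
    have := (hgpos n).ne'
    field_simp
  have hx : Tendsto (fun x : ℕ => (x : ℝ) ^ (1 - β)) atTop atTop :=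
    (tendsto_rpow_atTop hb).comp tendsto_natCast_atTop_atTop
  have h7 := h6.sum_range (fun n => (hgpos n).le) (by simpa only [hsumg] using hx)
  have h8 := h7.tendsto_div_nhds_zero
  have h9 := (h8.div_const (α / (1 - β))).add_const 1
  rw [zero_div, zero_add] at h9
  refine h9.congr' ?_
  filter_upwards [hx.eventually_gt_atTop 0] with x hx0
  rw [hsuma, Finset.sum_sub_distrib, ← Finset.mul_sum, hsumg]
  generalize (x : ℝ) ^ (1 - β) = X at *
  generalize α / (1 - β) = c at *
  field_simp
  ring
end

section
/- Let α > 1 and let Y be a random variable taking values in {1,2,...} with P(Y = x) = x^{-α}/ζ(α) (the Zipf(α) law, ζ being the Riemann zeta function). Then for any finite set of distinct primes p₁,...,p_k and any natural numbers n₁,...,n_k, P(v_{p₁}(Y) = n₁, ..., v_{p_k}(Y) = n_k) = ∏_{i=1}^{k} p_i^{-α n_i} (1 - p_i^{-α}), where v_p(Y) denotes the p-adic valuation (exponent of p in the prime factorization) of Y. In particular, the prime valuations (v_p(Y))_{p prime} are independent, with v_p(Y) geometrically distributed with success probability 1 - p^{-α}. -/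
open MeasureTheory

lemma zipf_summable (α : ℝ) (hα : 1 < α) :
    Summable (fun x : ℕ => ((x + 1 : ℕ) : ℝ) ^ (-α)) :=
  (summable_nat_add_iff (f := fun x : ℕ => (x : ℝ) ^ (-α)) 1).2
    (Real.summable_nat_rpow.2 (by linarith))

lemma zipf_zeta (α : ℝ) (hα : 1 < α) :
    (riemannZeta (α : ℂ)).re = ∑' x : ℕ, ((x + 1 : ℕ) : ℝ) ^ (-α) := by
  rw [zeta_eq_tsum_one_div_nat_add_one_cpow (by simpa using hα)]
  have : ∀ x : ℕ, (1 : ℂ) / ((x : ℂ) + 1) ^ (α : ℂ) = ((((x + 1 : ℕ) : ℝ) ^ (-α) : ℝ) : ℂ) := by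
    intro x
    rw [Real.rpow_neg (by positivity), Complex.ofReal_inv, Complex.ofReal_cpow (by positivity)]
    simp
  rw [tsum_congr this, ← Complex.ofReal_tsum, Complex.ofReal_re]

lemma zipf_pos (α : ℝ) (hα : 1 < α) :
    0 < ∑' x : ℕ, ((x + 1 : ℕ) : ℝ) ^ (-α) :=
  (zipf_summable α hα).tsum_pos (fun x => by positivity) 0 (by positivity)

lemma zipf_sum_succ (α : ℝ) (hα : 1 < α) (μ : Measure ℕ)
    (hμ : ∀ x : ℕ, 1 ≤ x →
      μ {x} = ENNReal.ofReal ((x : ℝ) ^ (-α) / (riemannZeta (α : ℂ)).re)) :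
    ∑' x : ℕ, μ {x + 1} = 1 := by
  have hpos := zipf_pos α hα
  rw [tsum_congr (fun x : ℕ => hμ (x + 1) (Nat.succ_pos x)), zipf_zeta α hα]
  rw [← ENNReal.ofReal_tsum_of_nonneg, tsum_div_const, div_self hpos.ne', ENNReal.ofReal_one]
  · intro x
    positivity
  · exact (zipf_summable α hα).div_const _

lemma zipf_zero (α : ℝ) (hα : 1 < α) (μ : Measure ℕ)
    [IsProbabilityMeasure μ]
    (hμ : ∀ x : ℕ, 1 ≤ x →
      μ {x} = ENNReal.ofReal ((x : ℝ) ^ (-α) / (riemannZeta (α : ℂ)).re)) : μ {0} = 0 := by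
  have h1 := zipf_sum_succ α hα μ hμ
  have h2 : ∑' x : ℕ, μ {x} = 1 := by
    have h3 := lintegral_countable' (μ := μ) (fun _ : ℕ => (1 : ENNReal))
    simpa using h3.symm
  have h3 := tsum_eq_zero_add' (f := fun x : ℕ => μ {x}) ENNReal.summable
  rw [h2, h1] at h3
  by_contra hne
  have h4 : (1 : ENNReal) < μ {0} + 1 := by
    rw [add_comm]
    exact ENNReal.lt_add_right (by simp) hne
  exact h4.ne h3

lemma zipf_scale (α : ℝ) (μ : Measure ℕ)
    (hμ : ∀ x : ℕ, 1 ≤ x →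
      μ {x} = ENNReal.ofReal ((x : ℝ) ^ (-α) / (riemannZeta (α : ℂ)).re)) (h0 : μ {0} = 0)
    (c : ℕ) (hc : 0 < c) (S : Set ℕ) :
    μ ((fun y => c * y) '' S) = ENNReal.ofReal ((c : ℝ) ^ (-α)) * μ S := by
  have hi : Function.Injective (fun y : ℕ => c * y) := fun a b h => Nat.eq_of_mul_eq_mul_left hc h
  have hm : ∀ s : Set ℕ, MeasurableSet s → MeasurableSet ((fun y => c * y) '' s) :=
    fun _ _ => MeasurableSet.of_discrete
  have : Measure.comap (fun y => c * y) μ = ENNReal.ofReal ((c : ℝ) ^ (-α)) • μ := by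
    refine Measure.ext_of_singleton fun x => ?_
    rw [Measure.comap_apply _ hi hm _ (measurableSet_singleton x)]
    simp only [Set.image_singleton, Measure.smul_apply, smul_eq_mul]
    rcases Nat.eq_zero_or_pos x with rfl | hx
    · simp [h0]
    · rw [hμ x hx, hμ (c * x) (Nat.mul_pos hc hx), ← ENNReal.ofReal_mul (by positivity)]
      congr 1
      push_cast
      rw [Real.mul_rpow (by positivity) (by positivity), mul_div_assoc]
  rw [← Measure.comap_apply _ hi hm _ MeasurableSet.of_discrete, this]
  simp

lemma zipf_step (α : ℝ) (hα : 1 < α) (μ : Measure ℕ) [IsProbabilityMeasure μ]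
    (hμ : ∀ x : ℕ, 1 ≤ x →
      μ {x} = ENNReal.ofReal ((x : ℝ) ^ (-α) / (riemannZeta (α : ℂ)).re)) (h0 : μ {0} = 0)
    (p : ℕ) (hp : p.Prime) (n : ℕ) (A : Set ℕ) (hA : ∀ y, p * y ∈ A ↔ y ∈ A) :
    μ (A ∩ {y | y.factorization p = n}) =
      ENNReal.ofReal ((p : ℝ) ^ (-(α * (n : ℝ))) * (1 - (p : ℝ) ^ (-α))) * μ A := by
  have hAn : ∀ m y, p ^ m * y ∈ A ↔ y ∈ A := by
    intro m
    induction m with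
    | zero => simp
    | succ m ih => intro y; rw [pow_succ, mul_assoc, ih, hA]
  have hM : ∀ m : ℕ, μ ((fun y => p ^ m * y) '' A) =
      ENNReal.ofReal ((p : ℝ) ^ (-(α * (m : ℝ)))) * μ A := by
    intro m
    rw [zipf_scale α μ hμ h0 _ (pow_pos hp.pos m)]
    congr 2
    rw [Nat.cast_pow, ← Real.rpow_natCast, ← Real.rpow_mul (by positivity)]
    congr 1; ring
  have hp0 : (0 : ℝ) < p := by exact_mod_cast hp.pos
  have hae : μ (A ∩ {y | y.factorization p = n}) =
      μ ((fun y => p ^ n * y) '' A \ (fun y => p ^ (n + 1) * y) '' A) := by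
    have hi : ∀ m y, y ∈ (fun y => p ^ m * y) '' A ↔ y ∈ A ∧ p ^ m ∣ y := by
      intro m y
      constructor
      · rintro ⟨z, hz, rfl⟩
        exact ⟨(hAn m z).2 hz, dvd_mul_right _ _⟩
      · rintro ⟨hy, z, rfl⟩
        exact ⟨z, (hAn m z).1 hy, rfl⟩
    apply measure_congr
    have hne : ∀ᵐ y ∂μ, y ≠ 0 := by
      rw [ae_iff]; simpa using h0
    filter_upwards [hne] with y hy
    apply propext
    change (y ∈ A ∧ y.factorization p = n) ↔ (y ∈ (fun y => p ^ n * y) '' A ∧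
      ¬ y ∈ (fun y => p ^ (n + 1) * y) '' A)
    rw [hi, hi, hp.pow_dvd_iff_le_factorization hy, hp.pow_dvd_iff_le_factorization hy]
    constructor
    · rintro ⟨h, h'⟩
      exact ⟨⟨h, h'.ge⟩, fun h => by omega⟩
    · rintro ⟨⟨h, h'⟩, h''⟩
      refine ⟨h, ?_⟩
      by_contra hne
      exact h'' ⟨h, by omega⟩
  rw [hae, measure_diff _ MeasurableSet.of_discrete.nullMeasurableSet (measure_ne_top _ _), hM, hM,
    ← ENNReal.sub_mul (fun _ _ => measure_ne_top _ _), ← ENNReal.ofReal_sub _ (by positivity)]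
  · congr 2
    rw [mul_sub, mul_one, ← Real.rpow_add hp0]
    congr 2
    push_cast; ring
  · rintro _ ⟨z, hz, rfl⟩
    exact ⟨p * z, (hA z).2 hz, by simp only; ring⟩

/-- Prime factorization of a Zipf(α) random variable: if `μ` is the law on ℕ
with `μ {x} = x^{-α}/ζ(α)` for `x ≥ 1`, then for any finite family of distinct
primes `p₁,…,p_k` and naturals `n₁,…,n_k`,
`μ {y | v_{p_i}(y) = n_i ∀i} = ∏_i p_i^{-α n_i} (1 - p_i^{-α})`; in
particular the p-adic valuations are independent geometric random variables. -/
theorem zipf_prime_valuations (α : ℝ) (hα : 1 < α) (μ : Measure ℕ)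
    [IsProbabilityMeasure μ]
    (hμ : ∀ x : ℕ, 1 ≤ x →
      μ {x} = ENNReal.ofReal ((x : ℝ) ^ (-α) / (riemannZeta (α : ℂ)).re))
    (k : ℕ) (p : Fin k → ℕ) (hp : ∀ i, (p i).Prime)
    (hinj : Function.Injective p) (n : Fin k → ℕ) :
    μ {y : ℕ | ∀ i : Fin k, y.factorization (p i) = n i} =
      ∏ i : Fin k, ENNReal.ofReal
        ((p i : ℝ) ^ (-(α * (n i : ℝ))) * (1 - (p i : ℝ) ^ (-α))) := by
  have h0 := zipf_zero α hα μ hμ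
  have key : ∀ s : Finset (Fin k), μ {y : ℕ | ∀ i ∈ s, y.factorization (p i) = n i} =
      ∏ i ∈ s, ENNReal.ofReal
        ((p i : ℝ) ^ (-(α * (n i : ℝ))) * (1 - (p i : ℝ) ^ (-α))) := by
    intro s
    induction s using Finset.induction_on with
    | empty => simp
    | insert j s hj ih =>
      rw [Finset.prod_insert hj, ← ih, ← zipf_step α hα μ hμ h0 (p j) (hp j)]
      · congr 1
        ext y
        simp [and_comm]
      · intro y
        rcases Nat.eq_zero_or_pos y with rfl | hy
        · simp
        · simp only [Set.mem_setOf_eq]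
          refine forall₂_congr fun i hi => ?_
          have hne : p j ≠ p i := fun h => hj (hinj h ▸ hi)
          rw [Nat.factorization_mul (hp j).ne_zero hy.ne', (hp j).factorization]
          simp [Finsupp.single_apply, hne]
  simpa using key Finset.univ
end

section
/- Let (a_k)_{k≥1} be a sequence of nonnegative reals with ∑_{k≥1} a_k = 1 and finite mean μ = ∑_{k≥1} k a_k < ∞, and set π_x = (1/μ) ∑_{k>x} a_k for x ≥ 0. Then for every x ≥ 0, ∑_{y≥x} C(y,x) (∫₀¹ u^x (1-u)^{y-x} du) ((y+1) a_{y+1} / μ) = π_x, where C(y,x) is the binomial coefficient. -/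
theorem beta_nat_aux (j : ℕ) : ∀ x : ℕ,
    (∫ u in (0 : ℝ)..1, u ^ x * (1 - u) ^ j) * ((x + j + 1).factorial : ℝ)
      = (x.factorial : ℝ) * (j.factorial : ℝ) := by
  induction j with
  | zero =>
    intro x
    have h0 : ((x : ℝ) + 1) ≠ 0 := by positivity
    simp only [pow_zero, mul_one, integral_pow, add_zero, Nat.factorial_succ, Nat.factorial_zero]
    push_cast
    field_simp
    simp
  | succ j ih =>
    intro x
    have hd : ∀ u : ℝ, HasDerivAt (fun u : ℝ => u ^ (x + 1) * (1 - u) ^ (j + 1))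
        (((x : ℝ) + 1) * (u ^ x * (1 - u) ^ (j + 1))
          - ((j : ℝ) + 1) * (u ^ (x + 1) * (1 - u) ^ j)) u := by
      intro u
      have h1 := (hasDerivAt_pow (x + 1) u).mul
        (((hasDerivAt_id u).const_sub 1).pow (j + 1))
      refine HasDerivAt.congr_deriv (f := fun u : ℝ => u ^ (x + 1) * (1 - u) ^ (j + 1)) h1 ?_
      simp only [Pi.pow_apply, id, Nat.add_sub_cancel]
      push_cast
      ring
    have hi := intervalIntegral.integral_eq_sub_of_hasDerivAt (a := 0) (b := 1)
      (fun u _ => hd u) (Continuous.intervalIntegrable (by fun_prop) _ _)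
    rw [intervalIntegral.integral_sub (Continuous.intervalIntegrable (by fun_prop) _ _)
      (Continuous.intervalIntegrable (by fun_prop) _ _),
      intervalIntegral.integral_const_mul, intervalIntegral.integral_const_mul] at hi
    simp at hi
    have h2 := ih (x + 1)
    have h0 : ((x : ℝ) + 1) ≠ 0 := by positivity
    apply mul_left_cancel₀ h0
    rw [show x + (j + 1) + 1 = x + 1 + j + 1 by ring]
    rw [Nat.factorial_succ x] at h2
    rw [Nat.factorial_succ j]
    push_cast at h2 ⊢
    linear_combination ((x + 1 + j + 1).factorial : ℝ) * hi + ((j : ℝ) + 1) * h2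

/-- The uniform thinning of the (shifted) size-biased return time has the
stationary law: if `(a_k)_{k≥1}` is a probability law with finite mean `μ` and
`π_x = (1/μ) ∑_{k>x} a_k`, then for every `x ≥ 0`,
`∑_{y≥x} C(y,x) (∫₀¹ u^x (1-u)^{y-x} du) ((y+1) a_{y+1}/μ) = π_x`. -/
theorem thinned_size_biased_is_stationary (a : ℕ → ℝ)
    (ha : ∀ k : ℕ, 1 ≤ k → 0 ≤ a k)
    (hsum : Summable fun k : ℕ => a (k + 1))
    (htot : (∑' k : ℕ, a (k + 1)) = 1)
    (hmean : Summable fun k : ℕ => ((k : ℝ) + 1) * a (k + 1))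
    (μ : ℝ) (hμ : μ = ∑' k : ℕ, ((k : ℝ) + 1) * a (k + 1)) (x : ℕ) :
    (∑' j : ℕ, ((x + j).choose x : ℝ) *
        (∫ u in (0 : ℝ)..1, u ^ x * (1 - u) ^ j) *
        (((x : ℝ) + (j : ℝ) + 1) * a (x + j + 1) / μ)) =
      (1 / μ) * ∑' j : ℕ, a (x + 1 + j) := by
  rw [← tsum_mul_left]
  refine tsum_congr fun j => ?_
  have hb := beta_nat_aux j x
  have hc : ((x + j).choose x : ℝ) * (x.factorial : ℝ) * (j.factorial : ℝ)
      = ((x + j).factorial : ℝ) := by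
    have := Nat.add_choose_mul_factorial_mul_factorial x j
    rw [Nat.choose_symm_add (a := x) (b := j)]
    exact_mod_cast this
  have hf : ((x + j).factorial : ℝ) ≠ 0 := by positivity
  have key : ((x + j).choose x : ℝ) * (∫ u in (0 : ℝ)..1, u ^ x * (1 - u) ^ j)
      * ((x : ℝ) + (j : ℝ) + 1) = 1 := by
    apply mul_left_cancel₀ hf
    rw [Nat.factorial_succ] at hb
    push_cast at hb
    linear_combination ((x + j).choose x : ℝ) * hb + hc
  rw [show x + 1 + j = x + j + 1 by ring]
  linear_combination (a (x + j + 1) / μ) * key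
end
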